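/- (Energy conservation identity, GOY model) For every u ∈ V and v ∈ V_{1/2}, the series Σ_{n=1}^∞ B(u,v)_n conj(v_n) converges absolutely and its real part vanishes: Re (B(u,v), v)_V = Re Σ_{n=1}^∞ B(u,v)_n conj(v_n) = 0. -/

import Mathlib

open scoped ComplexConjugate

/-- The wavenumbers `k_n = k₀ λ^n`. -/
noncomputable def kk (k0 lam : ℝ) (n : ℕ) : ℝ := k0 * lam ^ n

/-- Extension of a sequence (meaningful for indices `n ≥ 1`) by zero at index `0`,
realizing the convention `u₀ = u₋₁ = 0` (natural subtraction sends `-1` to `0`). -/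
def sh (u : ℕ → ℂ) (n : ℕ) : ℂ := if n = 0 then 0 else u n

/-- The GOY shell-model nonlinearity `b_n(u,v)`, for `n ≥ 1`. -/
noncomputable def bGOY (a b k0 lam : ℝ) (u v : ℕ → ℂ) (n : ℕ) : ℂ :=
  Complex.I * ((a : ℂ) * (kk k0 lam (n+1) : ℝ) * conj (sh u (n+1)) * conj (sh v (n+2))
    + (b : ℂ) * (kk k0 lam n : ℝ) * conj (sh u (n-1)) * conj (sh v (n+1))
    - (a : ℂ) * (kk k0 lam (n-1) : ℝ) * conj (sh u (n-1)) * conj (sh v (n-2))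
    - (b : ℂ) * (kk k0 lam (n-1) : ℝ) * conj (sh u (n-2)) * conj (sh v (n-1)))

/-- `B(u,v) = -(b₁(u,v), b₂(u,v), …)` for the GOY model. -/
noncomputable def BGOY (a b k0 lam : ℝ) (u v : ℕ → ℂ) (n : ℕ) : ℂ := - bGOY a b k0 lam u v n

theorem summable_mul_of_sq_summable {f g : ℕ → ℝ} (hf : Summable fun n => f n ^ 2)
    (hg : Summable fun n => g n ^ 2) (hf0 : ∀ n, 0 ≤ f n) (hg0 : ∀ n, 0 ≤ g n) :
    Summable fun n => f n * g n := by
  refine Summable.of_nonneg_of_le (fun n => mul_nonneg (hf0 n) (hg0 n)) (fun n => ?_) (hf.add hg)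
  nlinarith [sq_nonneg (f n - g n), sq_nonneg (f n), sq_nonneg (g n)]

theorem exists_norm_sh_le {u : ℕ → ℂ} (hu : Summable (fun n : ℕ => ‖u (n+1)‖^2)) :
    ∃ M : ℝ, 0 ≤ M ∧ ∀ n, ‖sh u n‖ ≤ M := by
  refine ⟨√(∑' n : ℕ, ‖u (n+1)‖^2), Real.sqrt_nonneg _, fun n => ?_⟩
  cases n with
  | zero => simp [sh]
  | succ n => simpa [sh] using Real.le_sqrt_of_sq_le (hu.le_tsum n fun j _ => sq_nonneg _)

theorem kk_pos {k0 lam : ℝ} (hk0 : 0 < k0) (hlam : 1 < lam) (n : ℕ) : 0 < kk k0 lam n := by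
  unfold kk
  positivity

theorem kk_mono {k0 lam : ℝ} (hk0 : 0 < k0) (hlam : 1 < lam) : Monotone (kk k0 lam) := by
  intro m n h
  unfold kk
  gcongr
  exact hlam.le

/-- Summability of a trilinear interaction of the shells `p n`, `n + d + 1` and `n + 1`. -/
theorem summable_interaction {k0 lam : ℝ} (hk0 : 0 < k0) (hlam : 1 < lam) {u v : ℕ → ℂ}
    (hu : Summable (fun n : ℕ => ‖u (n+1)‖^2))
    (hv : Summable (fun n : ℕ => (kk k0 lam (n+1))^2 * ‖v (n+1)‖^2))
    (c : ℂ) (p : ℕ → ℕ) (q d : ℕ) (hq : q ≤ d + 1) :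
    Summable fun n : ℕ => c * (kk k0 lam (n+q) : ℝ) * conj (sh u (p n)) * conj (v (n+d+1))
      * conj (v (n+1)) := by
  obtain ⟨M, hM0, hM⟩ := exists_norm_sh_le hu
  have hkpos := kk_pos hk0 hlam
  have hw : Summable fun n : ℕ => (kk k0 lam (n+1) * ‖v (n+1)‖) ^ 2 := by
    simpa only [mul_pow] using hv
  have hw0 : ∀ n : ℕ, 0 ≤ kk k0 lam (n+1) * ‖v (n+1)‖ := fun n =>
    mul_nonneg (hkpos _).le (norm_nonneg _)
  have hs := (summable_mul_of_sq_summable ((summable_nat_add_iff d).2 hw) hw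
    (fun n => hw0 (n+d)) hw0).mul_left (‖c‖ * M / k0)
  refine Summable.of_norm_bounded hs fun n => ?_
  have h1 : kk k0 lam (n+q) ≤ kk k0 lam (n+d+1) := kk_mono hk0 hlam (by omega)
  have h2 : k0 ≤ kk k0 lam (n+1) := by simpa [kk] using kk_mono hk0 hlam (Nat.zero_le (n+1))
  have h3 : ‖v (n+1)‖ ≤ kk k0 lam (n+1) * ‖v (n+1)‖ / k0 := by
    rw [le_div_iff₀ hk0, mul_comm]
    gcongr
  simp only [norm_mul, RCLike.norm_conj, Complex.norm_real, Real.norm_eq_abs,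
    abs_of_pos (hkpos _)]
  have hk := (hkpos (n+q)).le
  have hk' := (hkpos (n+d+1)).le
  calc ‖c‖ * kk k0 lam (n+q) * ‖sh u (p n)‖ * ‖v (n+d+1)‖ * ‖v (n+1)‖
      ≤ ‖c‖ * kk k0 lam (n+d+1) * M * ‖v (n+d+1)‖
        * (kk k0 lam (n+1) * ‖v (n+1)‖ / k0) := by
        gcongr
        exact hM _
    _ = _ := by ring

/-- Energy conservation identity for the GOY model: for `u ∈ V` and `v ∈ V_{1/2}`,
the series `Σ B(u,v)_n conj(v_n)` converges absolutely and `Re (B(u,v), v)_V = 0`. -/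
theorem stmt2 (k0 lam a b : ℝ) (hk0 : 0 < k0) (hlam : 1 < lam)
    (u v : ℕ → ℂ)
    (hu : Summable (fun n : ℕ => ‖u (n+1)‖^2))
    (hv : Summable (fun n : ℕ => (kk k0 lam (n+1))^2 * ‖v (n+1)‖^2)) :
    Summable (fun n : ℕ => ‖BGOY a b k0 lam u v (n+1) * conj (v (n+1))‖) ∧
    (∑' n : ℕ, BGOY a b k0 lam u v (n+1) * conj (v (n+1))).re = 0 := by
  set F : ℕ → ℂ := fun n => (a : ℂ) * (kk k0 lam (n+2) : ℝ) * conj (sh u (n+2))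
    * conj (v (n+2+1)) * conj (v (n+1)) with hF
  set G : ℕ → ℂ := fun n => (b : ℂ) * (kk k0 lam (n+1) : ℝ) * conj (sh u n)
    * conj (v (n+1+1)) * conj (v (n+1)) with hG
  have sF : Summable F := summable_interaction hk0 hlam hu hv a (fun n => n+2) 2 2 (by norm_num)
  have sG : Summable G := summable_interaction hk0 hlam hu hv b (fun n => n) 1 1 (by norm_num)
  set F' : ℕ → ℂ := fun n => (a : ℂ) * (kk k0 lam n : ℝ) * conj (sh u n)
    * conj (sh v (n-1)) * conj (v (n+1)) with hF'
  set G' : ℕ → ℂ := fun n => (b : ℂ) * (kk k0 lam n : ℝ) * conj (sh u (n-1))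
    * conj (sh v n) * conj (v (n+1)) with hG'
  have eF : ∀ n, F' (n+2) = F n := fun n => by
    simp only [hF, hF', sh, Nat.add_eq_zero_iff, show n + 2 - 1 = n + 1 by omega]
    simp
    ring
  have eG : ∀ n, G' (n+1) = G n := fun n => by
    simp only [hG, hG', sh, Nat.add_sub_cancel]
    simp
    ring
  have hasF : HasSum F' (∑' n, F n) := by
    have h : HasSum (fun n => F' (n+2)) (∑' n, F n) := by
      rw [show (fun n => F' (n+2)) = F from funext eF]
      exact sF.hasSum
    have h2 := (hasSum_nat_add_iff 2).1 h
    simpa [Finset.sum_range_succ, hF', sh] using h2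
  have hasG : HasSum G' (∑' n, G n) := by
    have h : HasSum (fun n => G' (n+1)) (∑' n, G n) := by
      rw [show (fun n => G' (n+1)) = G from funext eG]
      exact sG.hasSum
    have h2 := (hasSum_nat_add_iff 1).1 h
    simpa [hG', sh] using h2
  have key : (fun n : ℕ => BGOY a b k0 lam u v (n+1) * conj (v (n+1)))
      = fun n => -Complex.I * (F n + G n - F' n - G' n) := by
    funext n
    simp only [BGOY, bGOY, hF, hG, hF', hG', Nat.add_sub_cancel,
      show n + 1 - 2 = n - 1 by omega, show n + 1 + 1 = n + 2 by omega,
      show n + 1 + 2 = n + 3 by omega]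
    have h2 : sh v (n+2) = v (n+2) := by simp [sh]
    have h3 : sh v (n+3) = v (n+3) := by simp [sh]
    rw [h2, h3]
    ring
  have hsum : HasSum (fun n : ℕ => BGOY a b k0 lam u v (n+1) * conj (v (n+1))) 0 := by
    rw [key]
    have h := (((sF.hasSum.add sG.hasSum).sub hasF).sub hasG).mul_left (-Complex.I)
    rwa [add_sub_cancel_left, sub_self, mul_zero] at h
  exact ⟨hsum.summable.norm, by rw [hsum.tsum_eq, Complex.zero_re]⟩
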